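/- Let β ∈ (1,2), α > −1, ρ > 0, T > 0, and 0 < t₁ < t₂ < T. Let φ_ρ ∈ C^∞(ℝ²) satisfy 0 ≤ φ_ρ ≤ 1, φ_ρ ≡ 1 on B_{ρ/2}(0), and φ_ρ ≡ 0 outside B_ρ(0). Let Θ ∈ C¹(ℝ²) and suppose that for some r ∈ [1,∞) and γ ∈ ℝ one has ∫_{|y| ≤ L} |∇Θ(y)|^r dy ≲ L^γ for all sufficiently large L. For y ∈ ℝ² \ {0} define A_y = { t ∈ [t₁, t₂] : (ρ/8)/|y| ≤ (T−t)^{1/(1+α)} ≤ (ρ/4)/|y| } and Ṽ^{(1)}(y) = ∫_{t₁}^{t₂} | ∫_{ℝ²} |y−z|^{−β} ∇^⊥Θ(z) φ_ρ(z (T−t)^{1/(1+α)}) dz | 𝟙_{A_y}(t) dt, where ∇^⊥Θ = (−∂₂Θ, ∂₁Θ) and 𝟙_{A_y} is the indicator function of A_y. Then ∫_{L ≤ |y| ≤ 2L} |Ṽ^{(1)}(y)|^r dy ≲ L^{γ + r(1−α−β)} for all sufficiently large L, with implicit constant independent of t₁, t₂ and L. -/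

import Mathlib

open MeasureTheory Filter Metric Set
open scoped Topology

noncomputable section

/-- The plane `ℝ²`. -/
abbrev R2 : Type := EuclideanSpace ℝ (Fin 2)

/-- The rotation by 90 degrees: `(a, b)^⊥ = (-b, a)`. -/
def perp (v : R2) : R2 := (EuclideanSpace.equiv (Fin 2) ℝ).symm ![-(v 1), v 0]

/-- The set `A_y = { t ∈ [t₁,t₂] : ρ/(8|y|) ≤ (T-t)^{1/(1+α)} ≤ ρ/(4|y|) }`. -/
def timeSet (α ρ T t₁ t₂ : ℝ) (y : R2) : Set ℝ :=
  {t : ℝ | t ∈ Icc t₁ t₂ ∧ ρ / 8 / ‖y‖ ≤ (T - t) ^ (1 / (1 + α)) ∧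
    (T - t) ^ (1 / (1 + α)) ≤ ρ / 4 / ‖y‖}

/-- The function
`Ṽ⁽¹⁾(y) = ∫_{t₁}^{t₂} | ∫_{ℝ²} |y-z|^{-β} ∇^⊥Θ(z) φ_ρ(z (T-t)^{1/(1+α)}) dz | 𝟙_{A_y}(t) dt`. -/
def Vtilde (β α ρ T t₁ t₂ : ℝ) (φρ Θ : R2 → ℝ) (y : R2) : ℝ :=
  ∫ t in t₁..t₂,
    (timeSet α ρ T t₁ t₂ y).indicator
      (fun t => ‖∫ z : R2,
        ((‖y - z‖ ^ (-β)) * φρ (((T - t) ^ (1 / (1 + α))) • z)) • perp (gradient Θ z)‖) t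

open scoped ENNReal

theorem continuous_gradient_of_contDiff {F : Type*} [NormedAddCommGroup F] [InnerProductSpace ℝ F]
    [CompleteSpace F] {f : F → ℝ} (hf : ContDiff ℝ 1 f) : Continuous (gradient f) :=
  (InnerProductSpace.toDual ℝ F).symm.continuous.comp (hf.continuous_fderiv one_ne_zero)

theorem norm_perp (v : R2) : ‖perp v‖ = ‖v‖ := by
  simp [perp, EuclideanSpace.norm_eq, Fin.sum_univ_two, add_comm]

/-- Young's convolution inequality `‖K ∗ f‖_r ≤ ‖K‖₁ ‖f‖_r`, for nonnegative functions. -/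
theorem lintegral_convolution_rpow_le {G : Type*} [AddCommGroup G] [MeasurableSpace G]
    [MeasurableAdd₂ G] [MeasurableNeg G] {μ : Measure G} [SFinite μ] [μ.IsAddLeftInvariant]
    [μ.IsNegInvariant] {K f : G → ℝ≥0∞} (hK : Measurable K) (hf : Measurable f)
    {r : ℝ} (hr : 1 ≤ r) :
    ∫⁻ y, (∫⁻ z, K (y - z) * f z ∂μ) ^ r ∂μ ≤ (∫⁻ x, K x ∂μ) ^ r * ∫⁻ z, f z ^ r ∂μ := by
  have hr0 : 0 < r := one_pos.trans_le hr
  have hmeas : Measurable fun p : G × G => K (p.1 - p.2) * f p.2 ^ r :=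
    (hK.comp (measurable_fst.sub measurable_snd)).mul ((hf.comp measurable_snd).pow_const r)
  have hK' (y : G) : Measurable fun z => K (y - z) := hK.comp (measurable_const.sub measurable_id)
  have holder (y : G) : (∫⁻ z, K (y - z) * f z ∂μ) ^ r ≤
      (∫⁻ x, K x ∂μ) ^ (r - 1) * ∫⁻ z, K (y - z) * f z ^ r ∂μ := by
    have hp : 0 ≤ 1 - r⁻¹ := sub_nonneg.2 (inv_le_one_of_one_le₀ hr)
    have hq : 0 ≤ r⁻¹ := inv_nonneg.2 hr0.le
    have key := ENNReal.lintegral_mul_norm_pow_le (μ := μ) (hK' y).aemeasurable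
      ((hK' y).mul (hf.pow_const r)).aemeasurable hp hq (by ring)
    have hint (z : G) : K (y - z) ^ (1 - r⁻¹) * (K (y - z) * f z ^ r) ^ r⁻¹ = K (y - z) * f z := by
      rw [ENNReal.mul_rpow_of_nonneg _ _ hq, ← mul_assoc, ← ENNReal.rpow_add_of_nonneg _ _ hp hq,
        ← ENNReal.rpow_mul, mul_inv_cancel₀ hr0.ne']
      simp
    simp only [Pi.mul_apply, hint, lintegral_sub_left_eq_self] at key
    calc (∫⁻ z, K (y - z) * f z ∂μ) ^ r
        ≤ ((∫⁻ x, K x ∂μ) ^ (1 - r⁻¹) * (∫⁻ z, K (y - z) * f z ^ r ∂μ) ^ r⁻¹) ^ r :=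
          ENNReal.rpow_le_rpow key hr0.le
      _ = _ := by
          rw [ENNReal.mul_rpow_of_nonneg _ _ hr0.le, ← ENNReal.rpow_mul, ← ENNReal.rpow_mul,
            inv_mul_cancel₀ hr0.ne', ENNReal.rpow_one, sub_mul, inv_mul_cancel₀ hr0.ne', one_mul]
  calc ∫⁻ y, (∫⁻ z, K (y - z) * f z ∂μ) ^ r ∂μ
      ≤ ∫⁻ y, (∫⁻ x, K x ∂μ) ^ (r - 1) * ∫⁻ z, K (y - z) * f z ^ r ∂μ ∂μ :=
        lintegral_mono holder
    _ = (∫⁻ x, K x ∂μ) ^ (r - 1) * ∫⁻ z, ∫⁻ y, K (y - z) * f z ^ r ∂μ ∂μ := by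
        rw [lintegral_const_mul _ hmeas.lintegral_prod_right',
          lintegral_lintegral_swap hmeas.aemeasurable]
    _ = (∫⁻ x, K x ∂μ) ^ (r - 1) * ((∫⁻ x, K x ∂μ) * ∫⁻ z, f z ^ r ∂μ) := by
        congr 1
        rw [← lintegral_const_mul _ (hf.pow_const r)]
        refine lintegral_congr fun z => ?_
        have hKz : Measurable fun y => K (y - z) := hK.comp (measurable_id.sub_const z)
        rw [lintegral_mul_const _ hKz, lintegral_sub_right_eq_self]
    _ = (∫⁻ x, K x ∂μ) ^ r * ∫⁻ z, f z ^ r ∂μ := by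
        rw [← mul_assoc]
        congr 1
        conv_lhs => rw [← ENNReal.rpow_one (∫⁻ x, K x ∂μ), ← ENNReal.rpow_mul, one_mul]
        rw [← ENNReal.rpow_add_of_nonneg _ _ (sub_nonneg.2 hr) zero_le_one, sub_add_cancel]

/-- The kernel `|x|^{-β}` truncated to the ball of radius `R`. -/
def truncKernel (β R : ℝ) : R2 → ℝ≥0∞ :=
  (ball 0 R).indicator fun x => ENNReal.ofReal (‖x‖ ^ (-β))

theorem measurable_truncKernel (β R : ℝ) : Measurable (truncKernel β R) :=
  (measurable_norm.pow_const (-β)).ennreal_ofReal.indicator measurableSet_ball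

theorem lintegral_truncKernel_one_lt_top {β : ℝ} (hβ : β < 2) :
    ∫⁻ x, truncKernel β 1 x < ∞ := by
  have hint : IntegrableOn (fun x : R2 => ‖x‖ ^ (-β)) (ball 0 1) := by
    refine integrableOn_ball_of_norm_le_rpow (C := 1) (α := β) (by simp) (by simpa using hβ) ?_
      (measurable_norm.pow_const (-β)).aestronglyMeasurable
    refine Eventually.of_forall fun x => ?_
    rw [one_mul, Real.norm_of_nonneg (by positivity)]
  unfold truncKernel
  rw [lintegral_indicator measurableSet_ball]
  exact hint.lintegral_lt_top

theorem lintegral_truncKernel (β : ℝ) {R : ℝ} (hR : 0 < R) :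
    ∫⁻ x, truncKernel β R x = ENNReal.ofReal (R ^ (2 - β)) * ∫⁻ x, truncKernel β 1 x := by
  have hscale (x : R2) : truncKernel β R (R • x) =
      ENNReal.ofReal (R ^ (-β)) * truncKernel β 1 x := by
    by_cases hx : ‖x‖ < 1
    · have hRx : ‖R • x‖ < R := by
        rw [norm_smul, Real.norm_of_nonneg hR.le]
        nlinarith
      rw [truncKernel, truncKernel, indicator_of_mem (mem_ball_zero_iff.2 hRx),
        indicator_of_mem (mem_ball_zero_iff.2 hx), norm_smul, Real.norm_of_nonneg hR.le,
        Real.mul_rpow hR.le (norm_nonneg x), ENNReal.ofReal_mul (by positivity)]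
    · have hRx : ¬ ‖R • x‖ < R := by
        rw [norm_smul, Real.norm_of_nonneg hR.le]
        nlinarith
      rw [truncKernel, truncKernel, indicator_of_notMem (mt mem_ball_zero_iff.1 hRx),
        indicator_of_notMem (mt mem_ball_zero_iff.1 hx), mul_zero]
  have hmap := Measure.map_addHaar_smul (volume : Measure R2) hR.ne'
  have hchange : ∫⁻ x : R2, truncKernel β R (R • x) =
      ENNReal.ofReal (R ^ 2)⁻¹ * ∫⁻ x, truncKernel β R x := by
    rw [← lintegral_map (measurable_truncKernel β R) (measurable_const_smul R), hmap,
      lintegral_smul_measure, finrank_euclideanSpace_fin, abs_of_nonneg (by positivity),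
      smul_eq_mul]
  have hsq : ENNReal.ofReal (R ^ 2) * ENNReal.ofReal (R ^ 2)⁻¹ = 1 := by
    rw [← ENNReal.ofReal_mul (by positivity), mul_inv_cancel₀ (by positivity), ENNReal.ofReal_one]
  calc ∫⁻ x, truncKernel β R x
      = ENNReal.ofReal (R ^ 2) * ∫⁻ x : R2, truncKernel β R (R • x) := by
        rw [hchange, ← mul_assoc, hsq, one_mul]
    _ = ENNReal.ofReal (R ^ (2 - β)) * ∫⁻ x, truncKernel β 1 x := by
        simp_rw [hscale]
        rw [lintegral_const_mul _ (measurable_truncKernel β 1), ← mul_assoc,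
          ← ENNReal.ofReal_mul (by positivity), sub_eq_add_neg, Real.rpow_add hR, Real.rpow_two]

/-- The times in `A_y` lie within distance `(ρ/(4|y|))^{1+α}` of `T`. -/
theorem timeSet_subset_Icc {α ρ T t₁ t₂ L : ℝ} {y : R2} (hα : -1 < α) (hρ : 0 < ρ) (ht₂ : t₂ < T)
    (hL : 0 < L) (hy : L ≤ ‖y‖) :
    timeSet α ρ T t₁ t₂ y ⊆ Icc (T - (ρ / 4 / L) ^ (1 + α)) T := by
  rintro t ⟨ht, -, hle⟩
  have hα' : 0 < 1 + α := by linarith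
  have hTt : 0 ≤ T - t := by linarith [ht.2]
  have hle' : (T - t) ^ (1 / (1 + α)) ≤ ρ / 4 / L :=
    hle.trans (div_le_div_of_nonneg_left (by positivity) hL hy)
  have hpow := Real.rpow_le_rpow (by positivity) hle' hα'.le
  rw [← Real.rpow_mul hTt, one_div_mul_cancel hα'.ne', Real.rpow_one] at hpow
  exact ⟨by linarith, by linarith⟩

/-- On the annulus `L ≤ |y| ≤ 2L` and for `t ∈ A_y`, the cutoff restricts `z` to `|z| ≤ 16 L`. -/
theorem enorm_inner_integral_le {β α ρ T t₁ t₂ L t : ℝ} {φρ Θ : R2 → ℝ} {y : R2} (hρ : 0 < ρ)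
    (hφ01 : ∀ x, φρ x ∈ Icc (0:ℝ) 1) (hφzero : ∀ x ∉ ball (0:R2) ρ, φρ x = 0)
    (hL : 0 < L) (hy : L ≤ ‖y‖) (hy' : ‖y‖ ≤ 2 * L) (ht : t ∈ timeSet α ρ T t₁ t₂ y) :
    ‖∫ z : R2, ((‖y - z‖ ^ (-β)) * φρ (((T - t) ^ (1 / (1 + α))) • z)) • perp (gradient Θ z)‖ₑ ≤
      ∫⁻ z, truncKernel β (19 * L) (y - z) *
        (closedBall (0:R2) (16 * L)).indicator (fun z => ‖gradient Θ z‖ₑ) z := by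
  refine (enorm_integral_le_lintegral_enorm _).trans (lintegral_mono fun z => ?_)
  set s := (T - t) ^ (1 / (1 + α))
  have hs : ρ / 8 / (2 * L) ≤ s :=
    (div_le_div_of_nonneg_left (by positivity) (by linarith) hy').trans ht.2.1
  have hs0 : 0 < s := lt_of_lt_of_le (by positivity) hs
  by_cases hz : s • z ∈ ball (0:R2) ρ
  · have hsz : s * ‖z‖ < ρ := by
      rwa [mem_ball_zero_iff, norm_smul, Real.norm_of_nonneg hs0.le] at hz
    have hzL : ‖z‖ ≤ 16 * L := by
      have h1 : ρ / 8 / (2 * L) * ‖z‖ < ρ :=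
        (mul_le_mul_of_nonneg_right hs (norm_nonneg z)).trans_lt hsz
      have h2 : ρ / 8 / (2 * L) * ‖z‖ = ρ * (‖z‖ / (16 * L)) := by
        ring
      rw [h2] at h1
      have h3 : ‖z‖ / (16 * L) < 1 := by
        by_contra! h
        nlinarith
      exact ((div_lt_one (by positivity)).1 h3).le
    have hyz : ‖y - z‖ < 19 * L := by linarith [norm_sub_le y z]
    rw [truncKernel, indicator_of_mem (mem_ball_zero_iff.2 hyz),
      indicator_of_mem (mem_closedBall_zero_iff.2 hzL), enorm_smul, ← ofReal_norm (perp _),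
      norm_perp, ofReal_norm, Real.enorm_of_nonneg (mul_nonneg (by positivity) (hφ01 _).1)]
    gcongr
    exact mul_le_of_le_one_right (by positivity) (hφ01 _).2
  · simp [hφzero _ hz]

theorem enorm_Vtilde_le {β α ρ T t₁ t₂ L : ℝ} {φρ Θ : R2 → ℝ} {y : R2} (hα : -1 < α) (hρ : 0 < ρ)
    (hφ01 : ∀ x, φρ x ∈ Icc (0:ℝ) 1) (hφzero : ∀ x ∉ ball (0:R2) ρ, φρ x = 0)
    (ht : t₁ < t₂) (ht₂ : t₂ < T) (hL : 0 < L) (hy : L ≤ ‖y‖) (hy' : ‖y‖ ≤ 2 * L) :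
    ‖Vtilde β α ρ T t₁ t₂ φρ Θ y‖ₑ ≤ ENNReal.ofReal ((ρ / 4 / L) ^ (1 + α)) *
      ∫⁻ z, truncKernel β (19 * L) (y - z) *
        (closedBall (0:R2) (16 * L)).indicator (fun z => ‖gradient Θ z‖ₑ) z := by
  set G := ∫⁻ z, truncKernel β (19 * L) (y - z) *
        (closedBall (0:R2) (16 * L)).indicator (fun z => ‖gradient Θ z‖ₑ) z with hG
  rw [Vtilde, intervalIntegral.integral_of_le ht.le]
  calc _ ≤ ∫⁻ t in Ioc t₁ t₂, (Icc (T - (ρ / 4 / L) ^ (1 + α)) T).indicator (fun _ => G) t := by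
        refine (enorm_integral_le_lintegral_enorm _).trans (lintegral_mono fun t => ?_)
        by_cases htA : t ∈ timeSet α ρ T t₁ t₂ y
        · rw [indicator_of_mem htA, indicator_of_mem (timeSet_subset_Icc hα hρ ht₂ hL hy htA),
            enorm_norm]
          exact enorm_inner_integral_le hρ hφ01 hφzero hL hy hy' htA
        · rw [indicator_of_notMem htA, enorm_zero]
          exact zero_le
    _ ≤ ∫⁻ t, (Icc (T - (ρ / 4 / L) ^ (1 + α)) T).indicator (fun _ => G) t :=
        setLIntegral_le_lintegral _ _
    _ = ENNReal.ofReal ((ρ / 4 / L) ^ (1 + α)) * G := by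
        rw [lintegral_indicator_const measurableSet_Icc, Real.volume_Icc, sub_sub_cancel, mul_comm]

theorem lintegral_indicator_enorm_gradient_rpow {Θ : R2 → ℝ} (hΘ : ContDiff ℝ 1 Θ) {r : ℝ}
    (hr : 0 < r) (R : ℝ) :
    ∫⁻ z, (closedBall (0:R2) R).indicator (fun z => ‖gradient Θ z‖ₑ) z ^ r =
      ENNReal.ofReal (∫ y in closedBall (0:R2) R, ‖gradient Θ y‖ ^ r) := by
  have hcont : Continuous fun y => ‖gradient Θ y‖ ^ r :=
    (continuous_gradient_of_contDiff hΘ).norm.rpow_const fun _ => Or.inr hr.le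
  rw [ofReal_integral_eq_lintegral_ofReal
      (hcont.continuousOn.integrableOn_compact (isCompact_closedBall 0 R))
      (Eventually.of_forall fun _ => by positivity),
    ← lintegral_indicator measurableSet_closedBall]
  refine lintegral_congr fun z => ?_
  by_cases hz : z ∈ closedBall (0:R2) R
  · rw [indicator_of_mem hz, indicator_of_mem hz, ← ofReal_norm,
      ENNReal.ofReal_rpow_of_nonneg (norm_nonneg _) hr.le]
  · rw [indicator_of_notMem hz, indicator_of_notMem hz, ENNReal.zero_rpow_of_pos hr]

/-- **Lemma 4.1**: for `β ∈ (1,2)`, if `∫_{|y|≤L} |∇Θ|^r ≲ L^γ` for large `L`,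
then `∫_{L ≤ |y| ≤ 2L} |Ṽ⁽¹⁾(y)|^r ≲ L^{γ + r(1-α-β)}` for large `L`, with a
constant independent of `t₁`, `t₂` and `L`. -/
theorem Vtilde_dyadic_estimate
    (β α ρ T γ r : ℝ) (φρ Θ : R2 → ℝ)
    (hβ : β ∈ Ioo (1:ℝ) 2) (hα : -1 < α) (hρ : 0 < ρ) (hT : 0 < T)
    (hφsmooth : ContDiff ℝ (⊤ : ℕ∞) φρ)
    (hφ01 : ∀ x, φρ x ∈ Icc (0:ℝ) 1)
    (hφone : ∀ x ∈ ball (0:R2) (ρ / 2), φρ x = 1)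
    (hφzero : ∀ x ∉ ball (0:R2) ρ, φρ x = 0)
    (hΘC1 : ContDiff ℝ 1 Θ) (hr : 1 ≤ r)
    (hgrad : ∃ C L₁ : ℝ, ∀ L ≥ L₁,
      (∫ y in closedBall (0:R2) L, ‖gradient Θ y‖ ^ r) ≤ C * L ^ γ) :
    ∃ C L₀ : ℝ, 0 < C ∧ ∀ t₁ t₂ : ℝ, 0 < t₁ → t₁ < t₂ → t₂ < T → ∀ L ≥ L₀,
      (∫ y in {y : R2 | L ≤ ‖y‖ ∧ ‖y‖ ≤ 2 * L}, |Vtilde β α ρ T t₁ t₂ φρ Θ y| ^ r)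
        ≤ C * L ^ (γ + r * (1 - α - β)) := by
  have hr0 : 0 < r := one_pos.trans_le hr
  obtain ⟨C₀, L₁, hC₀⟩ := hgrad
  have hC₀' : ∀ L ≥ L₁, 0 < L →
      (∫ y in closedBall (0:R2) L, ‖gradient Θ y‖ ^ r) ≤ (|C₀| + 1) * L ^ γ := fun L hL hL0 =>
    (hC₀ L hL).trans (mul_le_mul_of_nonneg_right (by linarith [le_abs_self C₀]) (by positivity))
  set k := (∫⁻ x, truncKernel β 1 x).toReal
  have hk : ∫⁻ x, truncKernel β 1 x = ENNReal.ofReal k :=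
    (ENNReal.ofReal_toReal (lintegral_truncKernel_one_lt_top hβ.2).ne).symm
  have hk0 : 0 ≤ k := ENNReal.toReal_nonneg
  refine ⟨((ρ / 4) ^ (1 + α)) ^ r * (19 ^ (2 - β) * (k + 1)) ^ r * ((|C₀| + 1) * 16 ^ γ),
    max 1 L₁, by positivity, fun t₁ t₂ _ ht ht₂ L hL => ?_⟩
  have hL0 : 0 < L := one_pos.trans_le ((le_max_left _ _).trans hL)
  have hL16 : L₁ ≤ 16 * L := by linarith [(le_max_right _ _).trans hL]
  set a := (ρ / 4 / L) ^ (1 + α) with ha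
  set b := (19 * L) ^ (2 - β) * k with hb
  set c := (|C₀| + 1) * (16 * L) ^ γ with hc
  have ha0 : 0 ≤ a := by positivity
  have hb0 : 0 ≤ b := by positivity
  have hc0 : 0 ≤ c := by positivity
  set f : R2 → ℝ≥0∞ := (closedBall (0:R2) (16 * L)).indicator fun z => ‖gradient Θ z‖ₑ
  have hf : Measurable f :=
    (continuous_gradient_of_contDiff hΘC1).enorm.measurable.indicator measurableSet_closedBall
  have hS : MeasurableSet {y : R2 | L ≤ ‖y‖ ∧ ‖y‖ ≤ 2 * L} :=
    (measurableSet_le measurable_const measurable_norm).inter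
      (measurableSet_le measurable_norm measurable_const)
  have hbound : ENNReal.ofReal (∫ y in {y : R2 | L ≤ ‖y‖ ∧ ‖y‖ ≤ 2 * L},
      |Vtilde β α ρ T t₁ t₂ φρ Θ y| ^ r) ≤ ENNReal.ofReal (a ^ r * b ^ r * c) := by
    calc _ ≤ ∫⁻ y in {y : R2 | L ≤ ‖y‖ ∧ ‖y‖ ≤ 2 * L},
          ‖|Vtilde β α ρ T t₁ t₂ φρ Θ y| ^ r‖ₑ :=
          (Real.ofReal_le_enorm _).trans (enorm_integral_le_lintegral_enorm _)
      _ ≤ ∫⁻ y in {y : R2 | L ≤ ‖y‖ ∧ ‖y‖ ≤ 2 * L},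
          ENNReal.ofReal (a ^ r) * (∫⁻ z, truncKernel β (19 * L) (y - z) * f z) ^ r := by
          refine setLIntegral_mono' hS fun y hy => ?_
          rw [Real.enorm_of_nonneg (by positivity),
            ← ENNReal.ofReal_rpow_of_nonneg (abs_nonneg _) hr0.le, ← Real.enorm_eq_ofReal_abs,
            ← ENNReal.ofReal_rpow_of_nonneg ha0 hr0.le, ← ENNReal.mul_rpow_of_nonneg _ _ hr0.le]
          exact ENNReal.rpow_le_rpow
            (enorm_Vtilde_le hα hρ hφ01 hφzero ht ht₂ hL0 hy.1 hy.2) hr0.le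
      _ ≤ ∫⁻ y, ENNReal.ofReal (a ^ r) * (∫⁻ z, truncKernel β (19 * L) (y - z) * f z) ^ r :=
          setLIntegral_le_lintegral _ _
      _ = ENNReal.ofReal (a ^ r) * ∫⁻ y, (∫⁻ z, truncKernel β (19 * L) (y - z) * f z) ^ r :=
          lintegral_const_mul' _ _ ENNReal.ofReal_ne_top
      _ ≤ ENNReal.ofReal (a ^ r) * (ENNReal.ofReal b ^ r * ENNReal.ofReal c) := by
          gcongr
          refine (lintegral_convolution_rpow_le (measurable_truncKernel β _) hf hr).trans ?_
          rw [lintegral_truncKernel β (by positivity), hk, ← ENNReal.ofReal_mul (by positivity),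
            lintegral_indicator_enorm_gradient_rpow hΘC1 hr0]
          gcongr
          exact hC₀' _ hL16 (by positivity)
      _ = ENNReal.ofReal (a ^ r * b ^ r * c) := by
          rw [ENNReal.ofReal_rpow_of_nonneg hb0 hr0.le, ← ENNReal.ofReal_mul (by positivity),
            ← ENNReal.ofReal_mul (by positivity), mul_assoc]
  refine ((ENNReal.ofReal_le_ofReal_iff (by positivity)).1 hbound).trans ?_
  have ha' : a ^ r = ((ρ / 4) ^ (1 + α)) ^ r * L ^ (-(1 + α) * r) := by
    rw [ha, div_eq_mul_inv (ρ / 4), Real.mul_rpow (by positivity) (by positivity),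
      Real.mul_rpow (by positivity) (by positivity), Real.inv_rpow hL0.le,
      ← Real.rpow_neg hL0.le, ← Real.rpow_mul hL0.le]
  have hb' : b ^ r ≤ (19 ^ (2 - β) * (k + 1)) ^ r * L ^ ((2 - β) * r) := by
    rw [Real.rpow_mul hL0.le, ← Real.mul_rpow (by positivity) (by positivity), hb,
      Real.mul_rpow (by norm_num) hL0.le]
    refine Real.rpow_le_rpow (by positivity) ?_ hr0.le
    rw [mul_right_comm]
    gcongr
    linarith
  have hexp : L ^ (γ + r * (1 - α - β)) =
      L ^ (-(1 + α) * r) * L ^ ((2 - β) * r) * L ^ γ := by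
    rw [← Real.rpow_add hL0, ← Real.rpow_add hL0]
    congr 1
    ring
  calc a ^ r * b ^ r * c
      ≤ a ^ r * ((19 ^ (2 - β) * (k + 1)) ^ r * L ^ ((2 - β) * r)) * c := by gcongr
    _ = _ := by
        rw [ha', hc, hexp, Real.mul_rpow (by norm_num) hL0.le]
        ring
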